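/- Let d ≥ 1 and let f : ℝ^d → ℝ be ℓ-smooth, twice continuously differentiable and ρ-Hessian Lipschitz. For any η > 0, μ > 0 and x ∈ ℝ^d, the zeroth-order gradient descent step x' = x − η·∇̂_coord f(x) satisfies f(x) − f(x') ≥ ((η − 2η²ℓ)/2)·‖∇f(x)‖² − (η/2 + 2η²ℓ)·ρ² d μ⁴/36. -/

import Mathlib

/-- The central-difference coordinate-wise gradient estimator
`∇̂_coord f(x) = Σ_i ((f(x+μeᵢ) − f(x−μeᵢ))/(2μ)) eᵢ`. -/
noncomputable def coordGrad (d : ℕ) (f : EuclideanSpace ℝ (Fin d) → ℝ) (μ : ℝ)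
    (x : EuclideanSpace ℝ (Fin d)) : EuclideanSpace ℝ (Fin d) :=
  ∑ i : Fin d,
    ((f (x + μ • EuclideanSpace.single i 1) - f (x - μ • EuclideanSpace.single i 1)) / (2 * μ))
      • EuclideanSpace.single i 1

section SmoothnessEstimates

theorem norm_le_of_norm_deriv_le_pow {E : Type*} [NormedAddCommGroup E] [NormedSpace ℝ E]
    {F F' : ℝ → E} {C : ℝ} {n : ℕ} (hF : ∀ t, HasDerivAt F (F' t) t) (hF0 : F 0 = 0)
    (hbound : ∀ t, 0 ≤ t → ‖F' t‖ ≤ C * t ^ n) {t : ℝ} (ht : 0 ≤ t) :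
    ‖F t‖ ≤ C * (t ^ (n + 1) / (n + 1)) := by
  have hB : ∀ s : ℝ, HasDerivAt (fun s : ℝ => C * (s ^ (n + 1) / (n + 1))) (C * s ^ n) s := by
    intro s
    have h := ((hasDerivAt_pow (n + 1) s).div_const ((n : ℝ) + 1)).const_mul C
    refine h.congr_deriv ?_
    rw [Nat.add_sub_cancel]
    push_cast
    field_simp
  exact image_norm_le_of_norm_deriv_right_le_deriv_boundary (a := 0) (b := t)
    (fun s _ => (hF s).continuousAt.continuousWithinAt)
    (fun s _ => (hF s).hasDerivWithinAt) (by simp [hF0]) hB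
    (fun s hs => hbound s hs.1) ⟨ht, le_rfl⟩

variable {E : Type*} [NormedAddCommGroup E] [InnerProductSpace ℝ E] [CompleteSpace E]

theorem differentiable_gradient_of_contDiff_two {f : E → ℝ} (hf : ContDiff ℝ 2 f) :
    Differentiable ℝ (gradient f) :=
  (InnerProductSpace.toDual ℝ E).symm.toContinuousLinearEquiv.differentiable.comp
    ((hf.fderiv_right (m := 1) (by norm_num)).differentiable (by norm_num))

theorem hasDerivAt_comp_add_smul_gradient {f : E → ℝ} (hf : Differentiable ℝ f) (x v : E)
    (t : ℝ) : HasDerivAt (fun s : ℝ => f (x + s • v)) (inner ℝ (gradient f (x + t • v)) v) t := by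
  have hline : HasDerivAt (fun s : ℝ => x + s • v) v t := by
    simpa using ((hasDerivAt_id t).smul_const v).const_add x
  have h := (hf (x + t • v)).hasGradientAt.hasFDerivAt.comp_hasDerivAt t hline
  exact h.congr_deriv (by simp)

theorem le_add_inner_gradient_add_of_gradient_lipschitz {f : E → ℝ} (hf : Differentiable ℝ f)
    {ℓ : ℝ} (hlip : ∀ x y, ‖gradient f x - gradient f y‖ ≤ ℓ * ‖x - y‖) (x v : E) :
    f (x + v) ≤ f x + inner ℝ (gradient f x) v + ℓ / 2 * ‖v‖ ^ 2 := by
  have hF : ∀ t : ℝ, HasDerivAt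
      (fun s : ℝ => f (x + s • v) - f x - s * inner ℝ (gradient f x) v)
      (inner ℝ (gradient f (x + t • v) - gradient f x) v) t := by
    intro t
    have h := ((hasDerivAt_comp_add_smul_gradient hf x v t).sub_const (f x)).sub
      ((hasDerivAt_id t).mul_const (inner ℝ (gradient f x) v))
    exact h.congr_deriv (by rw [inner_sub_left, one_mul])
  have h := norm_le_of_norm_deriv_le_pow (C := ℓ * ‖v‖ ^ 2) (n := 1) hF (by simp)
    (fun t ht => by
      calc ‖inner ℝ (gradient f (x + t • v) - gradient f x) v‖
          ≤ ‖gradient f (x + t • v) - gradient f x‖ * ‖v‖ := norm_inner_le_norm _ _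
        _ ≤ ℓ * ‖x + t • v - x‖ * ‖v‖ := by gcongr; exact hlip _ _
        _ = ℓ * ‖v‖ ^ 2 * t ^ 1 := by
          rw [add_sub_cancel_left, norm_smul, Real.norm_of_nonneg ht]; ring) zero_le_one
  have h' := (le_abs_self _).trans h
  rw [one_smul] at h'
  norm_num at h' ⊢
  linarith

theorem norm_gradient_add_gradient_sub_le {f : E → ℝ} (hf : ContDiff ℝ 2 f) {ρ : ℝ}
    (hlip : ∀ x y, ‖fderiv ℝ (gradient f) x - fderiv ℝ (gradient f) y‖ ≤ ρ * ‖x - y‖)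
    (x v : E) {t : ℝ} (ht : 0 ≤ t) :
    ‖gradient f (x + t • v) + gradient f (x + t • -v) - (2 : ℝ) • gradient f x‖
      ≤ ρ * ‖v‖ ^ 2 * t ^ 2 := by
  have hline : ∀ (w : E) (t : ℝ), HasDerivAt (fun s : ℝ => gradient f (x + s • w))
      (fderiv ℝ (gradient f) (x + t • w) w) t := by
    intro w t
    have h : HasDerivAt (fun s : ℝ => x + s • w) w t := by
      simpa using ((hasDerivAt_id t).smul_const w).const_add x
    exact (differentiable_gradient_of_contDiff_two hf _).hasFDerivAt.comp_hasDerivAt t h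
  have h := norm_le_of_norm_deriv_le_pow (C := 2 * ρ * ‖v‖ ^ 2) (n := 1)
    (fun t => ((hline v t).add (hline (-v) t)).sub_const ((2 : ℝ) • gradient f x))
    (by simp [two_smul])
    (fun t ht => by
      rw [map_neg, ← sub_eq_add_neg, ← sub_apply]
      calc _ ≤ ‖fderiv ℝ (gradient f) (x + t • v) - fderiv ℝ (gradient f) (x + t • -v)‖ * ‖v‖ :=
            ContinuousLinearMap.le_opNorm _ _
        _ ≤ ρ * ‖x + t • v - (x + t • -v)‖ * ‖v‖ := by gcongr; exact hlip _ _
        _ = 2 * ρ * ‖v‖ ^ 2 * t ^ 1 := by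
          rw [show x + t • v - (x + t • -v) = (2 * t) • v by module, norm_smul,
            Real.norm_of_nonneg (by positivity)]
          ring) ht
  refine h.trans_eq ?_
  norm_num
  ring

theorem abs_central_difference_sub_inner_gradient_le {f : E → ℝ} (hf : ContDiff ℝ 2 f) {ρ : ℝ}
    (hlip : ∀ x y, ‖fderiv ℝ (gradient f) x - fderiv ℝ (gradient f) y‖ ≤ ρ * ‖x - y‖)
    (x v : E) {μ : ℝ} (hμ : 0 < μ) :
    |(f (x + μ • v) - f (x - μ • v)) / (2 * μ) - inner ℝ (gradient f x) v|
      ≤ ρ * ‖v‖ ^ 3 * μ ^ 2 / 6 := by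
  have hd : Differentiable ℝ f := hf.differentiable (by norm_num)
  have hF : ∀ t : ℝ, HasDerivAt
      (fun s : ℝ => f (x + s • v) - f (x + s • -v) - s * (2 * inner ℝ (gradient f x) v))
      (inner ℝ (gradient f (x + t • v) + gradient f (x + t • -v) - (2 : ℝ) • gradient f x) v)
      t := by
    intro t
    have h := ((hasDerivAt_comp_add_smul_gradient hd x v t).sub
      (hasDerivAt_comp_add_smul_gradient hd x (-v) t)).sub
      ((hasDerivAt_id t).mul_const (2 * inner ℝ (gradient f x) v))
    refine h.congr_deriv ?_
    rw [inner_sub_left, inner_add_left, real_inner_smul_left, inner_neg_right]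
    ring
  have h := norm_le_of_norm_deriv_le_pow (C := ρ * ‖v‖ ^ 3) (n := 2) hF (by simp)
    (fun t ht => by
      calc _ ≤ ‖gradient f (x + t • v) + gradient f (x + t • -v) - (2 : ℝ) • gradient f x‖
            * ‖v‖ := norm_inner_le_norm _ _
        _ ≤ ρ * ‖v‖ ^ 2 * t ^ 2 * ‖v‖ := by
          gcongr; exact norm_gradient_add_gradient_sub_le hf hlip x v ht
        _ = ρ * ‖v‖ ^ 3 * t ^ 2 := by ring) hμ.le
  rw [Real.norm_eq_abs, smul_neg, ← sub_eq_add_neg] at h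
  have heq : (f (x + μ • v) - f (x - μ • v)) / (2 * μ) - inner ℝ (gradient f x) v
      = (f (x + μ • v) - f (x - μ • v) - μ * (2 * inner ℝ (gradient f x) v)) / (2 * μ) := by
    field_simp
  rw [heq, abs_div, abs_of_pos (by positivity : 0 < 2 * μ), div_le_iff₀ (by positivity)]
  refine h.trans_eq ?_
  norm_num
  ring

end SmoothnessEstimates

theorem coordGrad_apply (d : ℕ) (f : EuclideanSpace ℝ (Fin d) → ℝ) (μ : ℝ)
    (x : EuclideanSpace ℝ (Fin d)) (i : Fin d) :
    coordGrad d f μ x i =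
      (f (x + μ • EuclideanSpace.single i 1) - f (x - μ • EuclideanSpace.single i 1))
        / (2 * μ) := by
  simp [coordGrad, Finset.sum_apply, Pi.single_apply]

theorem norm_coordGrad_sub_gradient_sq_le {d : ℕ} {f : EuclideanSpace ℝ (Fin d) → ℝ} {ρ : ℝ}
    (hf : ContDiff ℝ 2 f)
    (hlip : ∀ x y : EuclideanSpace ℝ (Fin d),
      ‖fderiv ℝ (gradient f) x - fderiv ℝ (gradient f) y‖ ≤ ρ * ‖x - y‖)
    {μ : ℝ} (hμ : 0 < μ) (x : EuclideanSpace ℝ (Fin d)) :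
    ‖coordGrad d f μ x - gradient f x‖ ^ 2 ≤ ρ ^ 2 * d * μ ^ 4 / 36 := by
  rw [EuclideanSpace.norm_sq_eq]
  have hi : ∀ i : Fin d, ‖(coordGrad d f μ x - gradient f x) i‖ ^ 2 ≤ (ρ * μ ^ 2 / 6) ^ 2 := by
    intro i
    have h := abs_central_difference_sub_inner_gradient_le hf hlip x
      (EuclideanSpace.single i (1 : ℝ)) hμ
    rw [← coordGrad_apply] at h
    have h' : ‖(coordGrad d f μ x - gradient f x) i‖ ≤ ρ * μ ^ 2 / 6 := by
      simpa [EuclideanSpace.inner_single_right, -inner_gradient_left] using h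
    gcongr
  refine (Finset.sum_le_sum fun i _ => hi i).trans_eq ?_
  simp only [Finset.sum_const, Finset.card_univ, Fintype.card_fin, nsmul_eq_mul]
  ring

/-- Descent of the zeroth-order gradient descent step: if `f : ℝ^d → ℝ` (`d ≥ 1`) is
`ℓ`-smooth, twice continuously differentiable and `ρ`-Hessian Lipschitz, then for any
`η > 0`, `μ > 0` and `x`, the step `x' = x − η ∇̂_coord f(x)` satisfies
`f(x) − f(x') ≥ ((η − 2η²ℓ)/2)‖∇f(x)‖² − (η/2 + 2η²ℓ)ρ²dμ⁴/36`. -/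
theorem zo_gd_descent (d : ℕ) (hd : 1 ≤ d) (f : EuclideanSpace ℝ (Fin d) → ℝ) (ℓ ρ : ℝ)
    (hf : ContDiff ℝ 2 f)
    (hGradLip : ∀ x y : EuclideanSpace ℝ (Fin d), ‖gradient f x - gradient f y‖ ≤ ℓ * ‖x - y‖)
    (hHessLip : ∀ x y : EuclideanSpace ℝ (Fin d),
      ‖fderiv ℝ (gradient f) x - fderiv ℝ (gradient f) y‖ ≤ ρ * ‖x - y‖)
    (η μ : ℝ) (hη : 0 < η) (hμ : 0 < μ) (x : EuclideanSpace ℝ (Fin d)) :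
    f x - f (x - η • coordGrad d f μ x)
      ≥ (η - 2 * η ^ 2 * ℓ) / 2 * ‖gradient f x‖ ^ 2
        - (η / 2 + 2 * η ^ 2 * ℓ) * (ρ ^ 2 * d * μ ^ 4 / 36) := by
  have hℓ : 0 ≤ ℓ := by
    have h := (norm_nonneg _).trans (hGradLip (EuclideanSpace.single ⟨0, hd⟩ 1) 0)
    simpa using h
  have hdesc := le_add_inner_gradient_add_of_gradient_lipschitz
    (hf.differentiable (by norm_num)) hGradLip x (-(η • coordGrad d f μ x))
  have herr := norm_coordGrad_sub_gradient_sq_le hf hHessLip hμ x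
  obtain ⟨e, he⟩ : ∃ e, coordGrad d f μ x = gradient f x + e := ⟨_, (add_sub_cancel _ _).symm⟩
  rw [he, add_sub_cancel_left] at herr
  rw [he] at hdesc ⊢
  rw [← sub_eq_add_neg, inner_neg_right, norm_neg, real_inner_smul_right, norm_smul, mul_pow,
    Real.norm_of_nonneg hη.le, inner_add_right, real_inner_self_eq_norm_sq] at hdesc
  have hadd := norm_add_sq_real (gradient f x) e
  have hsub := norm_sub_sq_real (gradient f x) e
  have hcross : -inner ℝ (gradient f x) e ≤ (‖gradient f x‖ ^ 2 + ‖e‖ ^ 2) / 2 := by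
    nlinarith [sq_nonneg ‖gradient f x + e‖]
  have hnorm : ‖gradient f x + e‖ ^ 2 ≤ 2 * ‖gradient f x‖ ^ 2 + 2 * ‖e‖ ^ 2 := by
    nlinarith [sq_nonneg ‖gradient f x - e‖]
  have hquad := mul_le_mul_of_nonneg_left hnorm (by positivity : 0 ≤ ℓ / 2 * η ^ 2)
  have hlin := mul_le_mul_of_nonneg_left hcross hη.le
  have hfinal := mul_le_mul_of_nonneg_left herr (by positivity : 0 ≤ η / 2 + 2 * η ^ 2 * ℓ)
  have hslack : 0 ≤ η ^ 2 * ℓ * ‖e‖ ^ 2 := by positivity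
  linarith
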